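/- For every interval translation map T ∈ ITM(r), the set X̄ ∖ {1} is equal to the non-wandering set Ω(T). -/

import Mathlib

open Set Filter
open scoped Classical

/-- An interval translation map on `r ≥ 2` intervals: discontinuity points
`0 = β₀ < β₁ < ⋯ < β_{r−1} < β_r = 1` and translation parameters
`γ_i ∈ [−β_{i−1}, 1−β_i]`, acting by `T(x) = x + γ_i` for `x ∈ [β_{i−1}, β_i)`. -/
structure ITM (r : ℕ) : Type where
  beta : Fin (r + 1) → ℝ
  gamma : Fin r → ℝ
  two_le_r : 2 ≤ r
  beta_zero : beta 0 = 0
  beta_last : beta (Fin.last r) = 1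
  beta_mono : StrictMono beta
  gamma_mem : ∀ i : Fin r, gamma i ∈ Set.Icc (-(beta i.castSucc)) (1 - beta i.succ)

namespace ITM

variable {r : ℕ}

/-- The unit interval `I = [0,1)`. -/
def unitIco : Set ℝ := Set.Ico 0 1

/-- Index of the partition interval `I_i = [β_{i−1}, β_i)` containing `x`. -/
noncomputable def idx (T : ITM r) (x : ℝ) : Fin r :=
  if h : ∃ i : Fin r, x ∈ Set.Ico (T.beta i.castSucc) (T.beta i.succ) then h.choose
  else ⟨0, by have := T.two_le_r; omega⟩

/-- The interval translation map itself (right-continuous version), extended by the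
identity off `[0,1)`. -/
noncomputable def f (T : ITM r) (x : ℝ) : ℝ :=
  if x ∈ unitIco then x + T.gamma (T.idx x) else x

/-- Index of the partition interval `(β_{i−1}, β_i]` containing `x` (left-limit version). -/
noncomputable def idxm (T : ITM r) (x : ℝ) : Fin r :=
  if h : ∃ i : Fin r, x ∈ Set.Ioc (T.beta i.castSucc) (T.beta i.succ) then h.choose
  else ⟨0, by have := T.two_le_r; omega⟩

/-- The left-limit version of `T`: `T(x⁻) = lim_{t↑x} T(t)`. -/
noncomputable def fm (T : ITM r) (x : ℝ) : ℝ :=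
  if x ∈ Set.Ioc (0 : ℝ) 1 then x + T.gamma (T.idxm x) else x

/-- Dynamics on signed points: `(x, true)` represents `x⁺` and `(x, false)` represents `x⁻`. -/
noncomputable def sf (T : ITM r) (p : ℝ × Bool) : ℝ × Bool :=
  if p.2 then (T.f p.1, true) else (T.fm p.1, false)

/-- `X_n = T^n(I)`. -/
noncomputable def Xn (T : ITM r) (n : ℕ) : Set ℝ := (T.f)^[n] '' unitIco

/-- The attractor `X = ⋂_{n≥0} X_n`. -/
noncomputable def X (T : ITM r) : Set ℝ := ⋂ n : ℕ, T.Xn n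

/-- The closure `X̄` of the attractor in `[0,1]` (equivalently, in `ℝ`). -/
noncomputable def Xbar (T : ITM r) : Set ℝ := closure T.X

/-- `T` is of finite type if `X_{n+1} = X_n` for some `n`. -/
def FiniteType (T : ITM r) : Prop := ∃ n : ℕ, T.Xn (n + 1) = T.Xn n

/-- The set of (unsigned) discontinuities `{β₁, …, β_{r−1}}` of `T`. -/
def critSet (T : ITM r) : Set ℝ :=
  {b : ℝ | ∃ i : Fin (r + 1), i ≠ 0 ∧ i ≠ Fin.last r ∧ b = T.beta i}

/-- The signed critical set `𝒞 = {β₁⁻, β₁⁺, …, β_{r−1}⁻, β_{r−1}⁺}`. -/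
def signedCrit (T : ITM r) : Set (ℝ × Bool) := {p : ℝ × Bool | p.1 ∈ T.critSet}

/-- `x` lands on a discontinuity of `T`: some forward iterate (`k ≥ 0`) is a discontinuity. -/
def landsOnCrit (T : ITM r) (x : ℝ) : Prop := ∃ k : ℕ, (T.f)^[k] x ∈ T.critSet

/-- The first return time of `x` to the set `J` (by convention `0` if `x` never returns). -/
noncomputable def returnTime (T : ITM r) (J : Set ℝ) (x : ℝ) : ℕ :=
  sInf {k : ℕ | 0 < k ∧ (T.f)^[k] x ∈ J}

/-- The first return map `R_J`. -/
noncomputable def returnMap (T : ITM r) (J : Set ℝ) (x : ℝ) : ℝ :=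
  (T.f)^[T.returnTime J x] x

/-- `J` is an interval component of `X`: a connected component of `X` which is a
(nondegenerate, half-open) interval `[x,y)`. -/
def IsIntervalComponent (T : ITM r) (J : Set ℝ) : Prop :=
  (∃ z ∈ T.X, J = connectedComponentIn T.X z) ∧ ∃ x y : ℝ, x < y ∧ J = Set.Ico x y

/-- A dynamically trivial interval component: no point of its interior lands on a
discontinuity and the first return map is the identity. -/
def DynTrivial (T : ITM r) (J : Set ℝ) : Prop :=
  T.IsIntervalComponent J ∧ (∀ a ∈ interior J, ¬ T.landsOnCrit a) ∧
    ∀ z ∈ J, T.returnMap J z = z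

/-- Signed membership in `[x,y)`: `+`-points of `[x,y)` and `−`-points of `(x,y]`. -/
def smem (x y : ℝ) (p : ℝ × Bool) : Prop :=
  if p.2 then p.1 ∈ Set.Ico x y else p.1 ∈ Set.Ioc x y

/-- First return time of a signed point to the interval `[x,y)`. -/
noncomputable def sReturnTime (T : ITM r) (x y : ℝ) (p : ℝ × Bool) : ℕ :=
  sInf {k : ℕ | 0 < k ∧ smem x y ((T.sf)^[k] p)}

/-- Condition A1: for every interval component `J` of `X` and every `a ∈ J`, the orbit of
`a` up to (and not including) its return time to `J` contains at most one critical point. -/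
def A1 (T : ITM r) : Prop :=
  ∀ J : Set ℝ, T.IsIntervalComponent J → ∀ a ∈ J,
    Set.Subsingleton {c : ℝ | c ∈ T.critSet ∧ ∃ k < T.returnTime J a, (T.f)^[k] a = c}

/-- Condition A2: for every dynamically non-trivial interval component `[x,y)`, neither
(signed) boundary point `x⁺`, `y⁻` lands on a discontinuity up to (and not including)
its return time. -/
def A2 (T : ITM r) : Prop :=
  ∀ x y : ℝ, T.IsIntervalComponent (Set.Ico x y) → ¬ T.DynTrivial (Set.Ico x y) →
    (∀ k < T.sReturnTime x y (x, true), (T.sf)^[k] (x, true) ∉ T.signedCrit) ∧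
    (∀ k < T.sReturnTime x y (y, false), (T.sf)^[k] (y, false) ∉ T.signedCrit)

/-- `c'` is a ghost preimage of `c`: a signed discontinuity of opposite sign whose
(signed) orbit lands on the point of `c` with the sign of `c'`. -/
def GhostPre (T : ITM r) (c' c : ℝ × Bool) : Prop :=
  c ∈ T.signedCrit ∧ c' ∈ T.signedCrit ∧ c'.2 = !c.2 ∧
    ∃ k : ℕ, (T.sf)^[k] c' = (c.1, c'.2)

/-- A descending chain of length `n` in a ghost tree: `c (i+1)` is a ghost preimage of `c i`. -/
def GhostChain (T : ITM r) (n : ℕ) (c : ℕ → ℝ × Bool) : Prop :=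
  ∀ i < n, T.GhostPre (c (i + 1)) (c i)

/-- `b` occurs as a vertex of positive level in its own ghost tree `GT(b)`. -/
def SelfGhost (T : ITM r) (b : ℝ × Bool) : Prop :=
  ∃ n : ℕ, 0 < n ∧ ∃ c : ℕ → ℝ × Bool, c 0 = b ∧ c n = b ∧ T.GhostChain n c

/-- Condition A3: no discontinuity `β ∉ X` occurs in its own ghost tree at positive level. -/
def A3 (T : ITM r) : Prop := ∀ b ∈ T.signedCrit, b.1 ∉ T.X → ¬ T.SelfGhost b

/-- The Absence of Critical Connections condition. -/
def ACC (T : ITM r) : Prop := T.A1 ∧ T.A2 ∧ T.A3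

/-- The Matching condition: for every dynamically non-trivial interval component `J` of
`X`, exactly one point of the interior of `J` lands on a critical point before returning. -/
def Matching (T : ITM r) : Prop :=
  ∀ J : Set ℝ, T.IsIntervalComponent J → ¬ T.DynTrivial J →
    ∃! a : ℝ, a ∈ interior J ∧ ∃ k < T.returnTime J a, (T.f)^[k] a ∈ T.critSet

/-- Distance between two maps in the parameter space `ITM(r)`. -/
noncomputable def pdist (T S : ITM r) : ℝ := dist T.gamma S.gamma ⊔ dist T.beta S.beta

/-- The number of discontinuities of `T` contained in `I ∖ X̄`. -/
noncomputable def ncritOutside (T : ITM r) : ℕ := (T.critSet \ T.Xbar).ncard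

/-- `T` is stable: on some neighbourhood `𝒰` of `T` in `ITM(r)`, the assignment
`T̃ ↦ X̄(T̃)` is continuous in the Hausdorff topology, all `X̄(T̃)` are homeomorphic to
`X̄(T)`, and the number of discontinuities in `I ∖ X̄(T̃)` is constant. -/
def Stable (T : ITM r) : Prop :=
  ∃ δ : ℝ, 0 < δ ∧
    (∀ S : ITM r, pdist S T < δ → Nonempty (S.Xbar ≃ₜ T.Xbar)) ∧
    (∀ S : ITM r, pdist S T < δ → ∀ ε : ℝ, 0 < ε → ∃ η : ℝ, 0 < η ∧
      ∀ S' : ITM r, pdist S' T < δ → pdist S' S < η →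
        Metric.hausdorffDist S'.Xbar S.Xbar < ε) ∧
    (∀ S : ITM r, pdist S T < δ → S.ncritOutside = T.ncritOutside)

/-- The non-wandering set `Ω(T)` (neighbourhoods taken inside `I = [0,1)`). -/
def nonwandering (T : ITM r) : Set ℝ :=
  {x : ℝ | x ∈ unitIco ∧ ∀ U : Set ℝ, IsOpen U → x ∈ U →
    ∃ n : ℕ, 0 < n ∧ ((T.f)^[n] '' (U ∩ unitIco) ∩ (U ∩ unitIco)).Nonempty}

/-- `S` and `S'` are topologically conjugate on the sets `A`, `B`: there is a
homeomorphism `h : A → B` with `h ∘ S = S' ∘ h` on `A`. -/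
def TopConjOn (S S' : ITM r) (A B : Set ℝ) : Prop :=
  ∃ h g : ℝ → ℝ, Set.BijOn h A B ∧ ContinuousOn h A ∧ Set.InvOn g h A B ∧
    ContinuousOn g B ∧ ∀ x ∈ A, h (S.f x) = S'.f (h x)

/-- No point of the interior of `K` lands on a discontinuity before its return time to `J`. -/
def NoCritBeforeReturnOn (T : ITM r) (J K : Set ℝ) : Prop :=
  ∀ z ∈ interior K, ∀ k < T.returnTime J z, (T.f)^[k] z ∉ T.critSet

/-- `K` is a continuity interval of the first return map `R_J`: a maximal half-open
subinterval of `J` no interior point of which lands on a discontinuity before returning. -/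
def IsContinuityInterval (T : ITM r) (J K : Set ℝ) : Prop :=
  (∃ u v : ℝ, u < v ∧ K = Set.Ico u v) ∧ K ⊆ J ∧ T.NoCritBeforeReturnOn J K ∧
    ∀ K' : Set ℝ, (∃ u v : ℝ, u < v ∧ K' = Set.Ico u v) → K ⊆ K' → K' ⊆ J →
      T.NoCritBeforeReturnOn J K' → K' = K

/-- The itinerary symbol of a signed point. -/
noncomputable def sidx (T : ITM r) (p : ℝ × Bool) : Fin r :=
  if p.2 then T.idx p.1 else T.idxm p.1

/-- The forward orbit of `x` accumulates on `c` from the left. -/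
def accumFromLeft (T : ITM r) (x c : ℝ) : Prop :=
  ∃ n : ℕ → ℕ, StrictMono n ∧ StrictMono (fun k => (T.f)^[n k] x) ∧
    Filter.Tendsto (fun k => (T.f)^[n k] x) Filter.atTop (nhds c)

/-- The forward orbit of `x` accumulates on `c` from the right. -/
def accumFromRight (T : ITM r) (x c : ℝ) : Prop :=
  ∃ n : ℕ → ℕ, StrictMono n ∧ StrictAnti (fun k => (T.f)^[n k] x) ∧
    Filter.Tendsto (fun k => (T.f)^[n k] x) Filter.atTop (nhds c)

end ITM

namespace ITM

variable {r : ℕ}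

open scoped Topology

lemma exists_mem_Ico (T : ITM r) {x : ℝ} (hx : x ∈ unitIco) :
    ∃ i : Fin r, x ∈ Ico (T.beta i.castSucc) (T.beta i.succ) := by
  have key : ∀ j : Fin (r + 1), x < T.beta j →
      ∃ i : Fin r, x ∈ Ico (T.beta i.castSucc) (T.beta i.succ) := by
    intro j
    induction j using Fin.induction with
    | zero =>
      intro h
      rw [T.beta_zero] at h
      exact absurd hx.1 (not_le.2 h)
    | succ j ih =>
      intro h
      by_cases h' : x < T.beta j.castSucc
      · exact ih h'
      · exact ⟨j, not_lt.1 h', h⟩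
  exact key (Fin.last r) (by rw [T.beta_last]; exact hx.2)

lemma beta_nonneg (T : ITM r) (i : Fin (r + 1)) : 0 ≤ T.beta i :=
  T.beta_zero ▸ T.beta_mono.monotone (Fin.zero_le i)

lemma beta_le_one (T : ITM r) (i : Fin (r + 1)) : T.beta i ≤ 1 :=
  T.beta_last ▸ T.beta_mono.monotone (Fin.le_last i)

lemma mem_unitIco_of_mem_Ico (T : ITM r) {x : ℝ} {i : Fin r}
    (hx : x ∈ Ico (T.beta i.castSucc) (T.beta i.succ)) : x ∈ unitIco :=
  ⟨(T.beta_nonneg _).trans hx.1, hx.2.trans_le (T.beta_le_one _)⟩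

lemma eq_of_mem_Ico (T : ITM r) {x : ℝ} {i j : Fin r}
    (hi : x ∈ Ico (T.beta i.castSucc) (T.beta i.succ))
    (hj : x ∈ Ico (T.beta j.castSucc) (T.beta j.succ)) : i = j := by
  have key : ∀ {i j : Fin r}, x ∈ Ico (T.beta i.castSucc) (T.beta i.succ) →
      x ∈ Ico (T.beta j.castSucc) (T.beta j.succ) → ¬ i < j := by
    intro i j hi hj hij
    have h : T.beta i.succ ≤ T.beta j.castSucc :=
      T.beta_mono.monotone (Fin.succ_le_castSucc_iff.2 hij)
    linarith [hi.2, hj.1]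
  exact le_antisymm (not_lt.1 (key hj hi)) (not_lt.1 (key hi hj))

lemma f_eq (T : ITM r) {x : ℝ} {i : Fin r}
    (hx : x ∈ Ico (T.beta i.castSucc) (T.beta i.succ)) : T.f x = x + T.gamma i := by
  have h : ∃ i : Fin r, x ∈ Ico (T.beta i.castSucc) (T.beta i.succ) := ⟨i, hx⟩
  have hidx : T.idx x = i := by
    rw [idx, dif_pos h]
    exact T.eq_of_mem_Ico h.choose_spec hx
  rw [f, if_pos (T.mem_unitIco_of_mem_Ico hx), hidx]

lemma f_mem_unitIco (T : ITM r) {x : ℝ} (hx : x ∈ unitIco) : T.f x ∈ unitIco := by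
  obtain ⟨i, hi⟩ := T.exists_mem_Ico hx
  rw [T.f_eq hi]
  have h := T.gamma_mem i
  exact ⟨by linarith [h.1, hi.1], by linarith [h.2, hi.2]⟩

lemma Xn_succ (T : ITM r) (n : ℕ) : T.Xn (n + 1) = T.f '' T.Xn n := by
  rw [Xn, Xn, Function.iterate_succ', image_comp]

lemma Xn_antitone (T : ITM r) : Antitone T.Xn := by
  refine antitone_nat_of_succ_le fun n => ?_
  rintro _ ⟨y, hy, rfl⟩
  exact ⟨T.f y, T.f_mem_unitIco hy, (Function.iterate_succ_apply _ _ _).symm⟩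

lemma Xn_subset_unitIco (T : ITM r) (n : ℕ) : T.Xn n ⊆ unitIco := by
  have h := T.Xn_antitone (Nat.zero_le n)
  simpa [Xn] using h

lemma X_subset_unitIco (T : ITM r) : T.X ⊆ unitIco :=
  (iInter_subset _ 0).trans (T.Xn_subset_unitIco 0)

lemma f_mem_Xn_succ (T : ITM r) {n : ℕ} {x : ℝ} (hx : x ∈ T.Xn n) : T.f x ∈ T.Xn (n + 1) := by
  rw [Xn_succ]
  exact mem_image_of_mem _ hx

lemma f_mem_X (T : ITM r) {x : ℝ} (hx : x ∈ T.X) : T.f x ∈ T.X :=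
  mem_iInter.2 fun n => T.Xn_antitone n.le_succ (T.f_mem_Xn_succ (mem_iInter.1 hx n))

/-- Compactness for a decreasing sequence of nonempty subsets of a finite type. -/
lemma exists_forall_of_antitone {ι : Type*} [Finite ι] {P : ι → ℕ → Prop}
    (hP : ∀ i, Antitone (P i)) (h : ∀ n, ∃ i, P i n) : ∃ i, ∀ n, P i n := by
  by_contra! hne
  choose N hN using hne
  obtain ⟨M, hM⟩ := (finite_range N).bddAbove
  obtain ⟨i, hi⟩ := h M
  exact hN i (hP i (hM (mem_range_self i)) hi)

lemma exists_preimage_mem_X (T : ITM r) {x : ℝ} (hx : x ∈ T.X) : ∃ z ∈ T.X, T.f z = x := by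
  obtain ⟨i, hi⟩ := exists_forall_of_antitone
    (P := fun (i : Fin r) n => x - T.gamma i ∈ T.Xn n ∧ T.f (x - T.gamma i) = x)
    (fun i m n hmn h => ⟨T.Xn_antitone hmn h.1, h.2⟩) (fun n => by
      have hn := mem_iInter.1 hx (n + 1)
      rw [Xn_succ] at hn
      obtain ⟨y, hy, hyx⟩ := hn
      obtain ⟨i, hi⟩ := T.exists_mem_Ico (T.Xn_subset_unitIco n hy)
      have hxy : x - T.gamma i = y := by rw [← hyx, T.f_eq hi]; ring
      exact ⟨i, by rwa [hxy], by rwa [hxy]⟩)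
  exact ⟨_, mem_iInter.2 fun n => (hi n).1, (hi 0).2⟩

lemma tendsto_sub_nhdsGT (x c : ℝ) : Tendsto (fun y => y - c) (𝓝[>] x) (𝓝[>] (x - c)) :=
  tendsto_nhdsWithin_of_tendsto_nhds_of_eventually_within _
    ((continuous_id.sub continuous_const).continuousAt.mono_left nhdsWithin_le_nhds)
    (eventually_mem_nhdsWithin.mono fun _ hy => sub_lt_sub_right (mem_Ioi.1 hy) c)

lemma tendsto_sub_nhdsLT (x c : ℝ) : Tendsto (fun y => y - c) (𝓝[<] x) (𝓝[<] (x - c)) :=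
  tendsto_nhdsWithin_of_tendsto_nhds_of_eventually_within _
    ((continuous_id.sub continuous_const).continuousAt.mono_left nhdsWithin_le_nhds)
    (eventually_mem_nhdsWithin.mono fun _ hy => sub_lt_sub_right (mem_Iio.1 hy) c)

lemma mem_Ico_of_frequently_nhdsGT {a b z : ℝ} (h : ∃ᶠ s in 𝓝[>] z, s ∈ Ico a b) :
    z ∈ Ico a b := by
  obtain ⟨s, hs, hzs⟩ := (h.and_eventually eventually_mem_nhdsWithin).exists
  refine ⟨not_lt.1 fun hza => ?_, (mem_Ioi.1 hzs).trans hs.2⟩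
  obtain ⟨s, hs, hsa⟩ := (h.and_eventually (nhdsWithin_le_nhds (Iio_mem_nhds hza))).exists
  exact absurd hs.1 (not_le.2 hsa)

lemma mem_Ioc_of_frequently_nhdsLT {a b z : ℝ} (h : ∃ᶠ s in 𝓝[<] z, s ∈ Ico a b) :
    z ∈ Ioc a b := by
  obtain ⟨s, hs, hzs⟩ := (h.and_eventually eventually_mem_nhdsWithin).exists
  refine ⟨hs.1.trans_lt hzs, not_lt.1 fun hbz => ?_⟩
  obtain ⟨s, hs, hsb⟩ := (h.and_eventually (nhdsWithin_le_nhds (Ioi_mem_nhds hbz))).exists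
  exact absurd hs.2 (not_lt.2 (mem_Ioi.1 hsb).le)

lemma exists_branch_of_frequently (T : ITM r) {l : Filter ℝ} {n : ℕ}
    (h : ∃ᶠ y in l, y ∈ T.Xn (n + 1)) :
    ∃ i, ∃ᶠ y in l, y - T.gamma i ∈ T.Xn n ∧
      y - T.gamma i ∈ Ico (T.beta i.castSucc) (T.beta i.succ) := by
  refine frequently_exists.1 (h.mono fun y hyn => ?_)
  rw [Xn_succ] at hyn
  obtain ⟨s, hs, rfl⟩ := hyn
  obtain ⟨i, hi⟩ := T.exists_mem_Ico (T.Xn_subset_unitIco n hs)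
  refine ⟨i, ?_⟩
  rw [T.f_eq hi, add_sub_cancel_right]
  exact ⟨hs, hi⟩

lemma mem_Xn_of_frequently_nhdsGT (T : ITM r) (n : ℕ) :
    ∀ {x : ℝ}, (∃ᶠ y in 𝓝[>] x, y ∈ T.Xn n) → x ∈ T.Xn n := by
  induction n with
  | zero =>
    intro x h
    simp only [Xn, Function.iterate_zero, image_id] at h ⊢
    exact mem_Ico_of_frequently_nhdsGT h
  | succ n ih =>
    intro x h
    obtain ⟨i, hi⟩ := T.exists_branch_of_frequently h
    have hz := (tendsto_sub_nhdsGT x (T.gamma i)).frequently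
        (p := fun s => s ∈ T.Xn n ∧ s ∈ Ico (T.beta i.castSucc) (T.beta i.succ)) hi
    have hmem := mem_Ico_of_frequently_nhdsGT (hz.mono fun _ h => h.2)
    have := T.f_mem_Xn_succ (ih (hz.mono fun _ h => h.1))
    rwa [T.f_eq hmem, sub_add_cancel] at this

/-- The points accumulated from the left by every `X_n`. -/
def leftLimits (T : ITM r) : Set ℝ := {x | ∀ n, ∃ᶠ y in 𝓝[<] x, y ∈ T.Xn n}

lemma leftLimits_subset (T : ITM r) : T.leftLimits ⊆ Ioc 0 1 := fun x hx => by
  have h := hx 0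
  simp only [Xn, Function.iterate_zero, image_id] at h
  exact mem_Ioc_of_frequently_nhdsLT h

lemma exists_branch_leftLimits (T : ITM r) {x : ℝ} (hx : x ∈ T.leftLimits) :
    ∃ i : Fin r, x - T.gamma i ∈ T.leftLimits ∧
      x - T.gamma i ∈ Ioc (T.beta i.castSucc) (T.beta i.succ) := by
  obtain ⟨i, hi⟩ := exists_forall_of_antitone
    (P := fun (i : Fin r) n => (∃ᶠ y in 𝓝[<] (x - T.gamma i), y ∈ T.Xn n) ∧
      x - T.gamma i ∈ Ioc (T.beta i.castSucc) (T.beta i.succ))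
    (fun i m n hmn h => ⟨h.1.mono fun _ hy => T.Xn_antitone hmn hy, h.2⟩) (fun n => by
      obtain ⟨i, hi⟩ := T.exists_branch_of_frequently (hx (n + 1))
      have hz := (tendsto_sub_nhdsLT x (T.gamma i)).frequently
        (p := fun s => s ∈ T.Xn n ∧ s ∈ Ico (T.beta i.castSucc) (T.beta i.succ)) hi
      exact ⟨i, hz.mono fun _ h => h.1, mem_Ioc_of_frequently_nhdsLT (hz.mono fun _ h => h.2)⟩)
  exact ⟨i, fun n => (hi n).1, (hi 0).2⟩

lemma eventually_beta_mem_X (T : ITM r) (i : Fin r) :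
    ∀ᶠ η in 𝓝[>] (0 : ℝ), ∀ w ∈ T.leftLimits,
      w ∈ Ioo (T.beta i.castSucc) (T.beta i.castSucc + η) → T.beta i.castSucc ∈ T.X := by
  by_cases hX : T.beta i.castSucc ∈ T.X
  · exact Eventually.of_forall fun _ _ _ _ => hX
  simp only [X, mem_iInter, not_forall] at hX
  obtain ⟨n, hn⟩ := hX
  have hev : ∀ᶠ y in 𝓝[>] (T.beta i.castSucc), y ∉ T.Xn n :=
    not_frequently.1 fun h => hn (T.mem_Xn_of_frequently_nhdsGT n h)
  obtain ⟨u, hu, hsub⟩ := mem_nhdsGT_iff_exists_Ioo_subset.1 hev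
  have hpos : (0 : ℝ) < u - T.beta i.castSucc := sub_pos.2 hu
  filter_upwards [Ioo_mem_nhdsGT hpos] with η hη w hw hwη
  obtain ⟨y, hy, hyw, hyβ⟩ := ((hw n).and_eventually
    (eventually_mem_nhdsWithin.and (nhdsWithin_le_nhds (Ioi_mem_nhds hwη.1)))).exists
  have hyu : y < u := by linarith [hwη.2, hη.2, mem_Iio.1 hyw]
  exact absurd hy (hsub ⟨hyβ, hyu⟩)

lemma leftLimits_subset_closure (T : ITM r) : T.leftLimits ⊆ closure T.X := by
  intro x hx
  rw [Metric.mem_closure_iff]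
  intro ε hε
  obtain ⟨η, hη, hηpos, hηε⟩ :=
    ((eventually_all.2 T.eventually_beta_mem_X).and (Ioo_mem_nhdsGT hε)).exists
  have hzero : ∀ w ∈ T.leftLimits, w < η → (0 : ℝ) ∈ T.X := by
    intro w hw hwη
    have h := hη ⟨0, by have := T.two_le_r; omega⟩ w hw
    have h0 : T.beta (Fin.castSucc ⟨0, by have := T.two_le_r; omega⟩) = 0 := T.beta_zero
    rw [h0] at h
    exact h ⟨(T.leftLimits_subset hw).1, by linarith⟩
  have key : ∀ n, ∀ w ∈ T.leftLimits, (∃ y ∈ T.X, y ∈ Ico (w - η) w) ∨ w - η ∈ T.Xn n := by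
    intro n
    induction n with
    | zero =>
      intro w hw
      have hw' := T.leftLimits_subset hw
      by_cases h : w < η
      · exact Or.inl ⟨0, hzero w hw h, by linarith, hw'.1⟩
      · refine Or.inr ?_
        simp only [Xn, Function.iterate_zero, image_id]
        exact ⟨by linarith, by linarith [hw'.2]⟩
    | succ n ih =>
      intro w hw
      obtain ⟨i, hz, hzi⟩ := T.exists_branch_leftLimits hw
      have htrans : ∀ y ∈ Ico (T.beta i.castSucc) (w - T.gamma i), T.f y = y + T.gamma i :=
        fun y hy => T.f_eq ⟨hy.1, hy.2.trans_le hzi.2⟩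
      by_cases h : w - T.gamma i < T.beta i.castSucc + η
      · have hβ := hη i _ hz ⟨hzi.1, h⟩
        refine Or.inl ⟨_, T.f_mem_X hβ, ?_⟩
        rw [htrans _ ⟨le_rfl, hzi.1⟩]
        exact ⟨by linarith, by linarith [hzi.1]⟩
      · rcases ih _ hz with ⟨y, hy, hyI⟩ | hy
        · refine Or.inl ⟨_, T.f_mem_X hy, ?_⟩
          rw [htrans _ ⟨by linarith [hyI.1], hyI.2⟩]
          exact ⟨by linarith [hyI.1], by linarith [hyI.2]⟩
        · have := T.f_mem_Xn_succ hy
          rw [htrans _ ⟨by linarith, by linarith⟩] at this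
          right
          convert this using 1
          ring
  by_cases h : ∃ y ∈ T.X, y ∈ Ico (x - η) x
  · obtain ⟨y, hy, hyI⟩ := h
    refine ⟨y, hy, ?_⟩
    rw [Real.dist_eq, abs_lt]
    exact ⟨by linarith [hyI.2], by linarith [hyI.1]⟩
  · exact absurd ⟨x - η, mem_iInter.2 fun n => (key n x hx).resolve_left h, le_rfl, by linarith⟩ h

lemma iInter_closure_Xn_subset (T : ITM r) : ⋂ n, closure (T.Xn n) ⊆ closure T.X := by
  intro x hx
  by_cases hX : x ∈ T.X
  · exact subset_closure hX
  refine T.leftLimits_subset_closure fun n => ?_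
  obtain ⟨m, hm⟩ : ∃ m, x ∉ T.Xn m := by simpa [X] using hX
  have hnot : x ∉ T.Xn (max n m) := fun h => hm (T.Xn_antitone (le_max_right _ _) h)
  have hfreq : ∃ᶠ y in 𝓝 x, y ∈ T.Xn (max n m) :=
    mem_closure_iff_frequently.1 (mem_iInter.1 hx _)
  have hright : ∀ᶠ y in 𝓝[>] x, y ∉ T.Xn (max n m) :=
    not_frequently.1 fun h => hnot (T.mem_Xn_of_frequently_nhdsGT _ h)
  intro hleft
  refine hfreq ?_
  rw [← nhdsNE_sup_pure, ← nhdsLT_sup_nhdsGT]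
  exact eventually_sup.2 ⟨eventually_sup.2
    ⟨hleft.mono fun y hy h => hy (T.Xn_antitone (le_max_left _ _) h), hright⟩,
    eventually_pure.2 hnot⟩

lemma exists_eventually_nhdsGT_f_eq (T : ITM r) (x : ℝ) :
    ∃ c, ∀ᶠ y in 𝓝[>] x, T.f y = y + c := by
  by_cases h : ∃ᶠ y in 𝓝[>] x, y ∈ unitIco
  · obtain ⟨i, hi⟩ := frequently_exists.1 (h.mono fun y hy => T.exists_mem_Ico hy)
    have hx := mem_Ico_of_frequently_nhdsGT hi
    exact ⟨T.gamma i, mem_of_superset (Ioo_mem_nhdsGT hx.2) fun y hy =>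
      T.f_eq ⟨hx.1.trans hy.1.le, hy.2⟩⟩
  · exact ⟨0, (not_frequently.1 h).mono fun y hy => by rw [f, if_neg hy, add_zero]⟩

lemma exists_eventually_nhdsLT_f_eq (T : ITM r) (x : ℝ) :
    ∃ c, ∀ᶠ y in 𝓝[<] x, T.f y = y + c := by
  by_cases h : ∃ᶠ y in 𝓝[<] x, y ∈ unitIco
  · obtain ⟨i, hi⟩ := frequently_exists.1 (h.mono fun y hy => T.exists_mem_Ico hy)
    have hx := mem_Ioc_of_frequently_nhdsLT hi
    exact ⟨T.gamma i, mem_of_superset (Ioo_mem_nhdsLT hx.1) fun y hy =>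
      T.f_eq ⟨hy.1.le, hy.2.trans_le hx.2⟩⟩
  · exact ⟨0, (not_frequently.1 h).mono fun y hy => by rw [f, if_neg hy, add_zero]⟩

lemma exists_eventually_nhdsGT_iterate_eq (T : ITM r) (x : ℝ) (n : ℕ) :
    ∃ c, ∀ᶠ y in 𝓝[>] x, T.f^[n] y = y + c := by
  induction n with
  | zero => exact ⟨0, Eventually.of_forall fun y => (add_zero y).symm⟩
  | succ n ih =>
    obtain ⟨c, hc⟩ := ih
    obtain ⟨d, hd⟩ := T.exists_eventually_nhdsGT_f_eq (x - -c)
    refine ⟨c + d, ?_⟩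
    filter_upwards [hc, (tendsto_sub_nhdsGT x (-c)).eventually hd] with y hy hy'
    rw [Function.iterate_succ_apply', hy, ← sub_neg_eq_add, hy']
    ring

lemma exists_eventually_nhdsLT_iterate_eq (T : ITM r) (x : ℝ) (n : ℕ) :
    ∃ c, ∀ᶠ y in 𝓝[<] x, T.f^[n] y = y + c := by
  induction n with
  | zero => exact ⟨0, Eventually.of_forall fun y => (add_zero y).symm⟩
  | succ n ih =>
    obtain ⟨c, hc⟩ := ih
    obtain ⟨d, hd⟩ := T.exists_eventually_nhdsLT_f_eq (x - -c)
    refine ⟨c + d, ?_⟩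
    filter_upwards [hc, (tendsto_sub_nhdsLT x (-c)).eventually hd] with y hy hy'
    rw [Function.iterate_succ_apply', hy, ← sub_neg_eq_add, hy']
    ring

lemma mem_X_of_isPeriodicPt (T : ITM r) {x : ℝ} {n : ℕ} (hn : 0 < n) (hx : x ∈ unitIco)
    (h : Function.IsPeriodicPt T.f n x) : x ∈ T.X :=
  mem_iInter.2 fun k => T.Xn_antitone (Nat.le_mul_of_pos_left k hn) ⟨x, hx, h.mul_const k⟩

lemma exists_nhds_forall_iterate_notMem_of_translation (T : ITM r) {x c : ℝ} {n : ℕ} (hn : 0 < n)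
    (hx : x ∉ closure T.X) {l : Filter ℝ} (hl : l ≤ 𝓝 x)
    (hc : ∀ᶠ y in l, T.f^[n] y = y + c) :
    ∃ U ∈ 𝓝 x, ∀ᶠ y in l, y ∈ unitIco → T.f^[n] y ∉ U := by
  by_cases h0 : c = 0
  · refine ⟨(closure T.X)ᶜ, isClosed_closure.isOpen_compl.mem_nhds hx, hc.mono fun y hy hyI hU => ?_⟩
    rw [h0, add_zero] at hy
    rw [hy] at hU
    exact hU (subset_closure (T.mem_X_of_isPeriodicPt hn hyI hy))
  · have hpos : 0 < |c| / 2 := half_pos (abs_pos.2 h0)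
    refine ⟨Metric.ball x (|c| / 2), Metric.ball_mem_nhds x hpos, ?_⟩
    filter_upwards [hc, hl (Metric.ball_mem_nhds x hpos)] with y hy hyx _ hU
    rw [hy, Metric.mem_ball, Real.dist_eq] at hU
    rw [Metric.mem_ball, Real.dist_eq] at hyx
    have htri : |c| ≤ |y + c - x| + |y - x| := by
      have := abs_sub (y + c - x) (y - x)
      rwa [show y + c - x - (y - x) = c by ring] at this
    linarith

lemma exists_nhds_disjoint_iterate (T : ITM r) {x : ℝ} (hx : x ∉ closure T.X) {n : ℕ}
    (hn : 0 < n) : ∃ V ∈ 𝓝 x, ∀ y ∈ V, y ∈ unitIco → T.f^[n] y ∉ V := by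
  obtain ⟨c, hc⟩ := T.exists_eventually_nhdsLT_iterate_eq x n
  obtain ⟨d, hd⟩ := T.exists_eventually_nhdsGT_iterate_eq x n
  have hp : ∀ᶠ y in pure x, T.f^[n] y = y + (T.f^[n] x - x) := eventually_pure.2 (by ring)
  obtain ⟨U₁, hU₁, h₁⟩ :=
    T.exists_nhds_forall_iterate_notMem_of_translation hn hx nhdsWithin_le_nhds hc
  obtain ⟨U₂, hU₂, h₂⟩ :=
    T.exists_nhds_forall_iterate_notMem_of_translation hn hx nhdsWithin_le_nhds hd
  obtain ⟨U₃, hU₃, h₃⟩ :=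
    T.exists_nhds_forall_iterate_notMem_of_translation hn hx (pure_le_nhds x) hp
  have hev : ∀ᶠ y in 𝓝 x, y ∈ unitIco → T.f^[n] y ∉ U₁ ∩ U₂ ∩ U₃ := by
    rw [← nhdsNE_sup_pure, ← nhdsLT_sup_nhdsGT]
    exact eventually_sup.2 ⟨eventually_sup.2
      ⟨h₁.mono fun y hy hyI h => hy hyI h.1.1, h₂.mono fun y hy hyI h => hy hyI h.1.2⟩,
      h₃.mono fun y hy hyI h => hy hyI h.2⟩
  exact ⟨_, inter_mem hev (inter_mem (inter_mem hU₁ hU₂) hU₃),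
    fun y hy hyI h => hy.1 hyI h.2⟩

lemma nonwandering_subset_closure (T : ITM r) : T.nonwandering ⊆ closure T.X := by
  rintro x ⟨-, hx⟩
  by_contra hX
  obtain ⟨N, hN⟩ : ∃ N, x ∉ closure (T.Xn N) := by
    by_contra! h
    exact hX (T.iInter_closure_Xn_subset (mem_iInter.2 h))
  choose! V hV hVd using fun (n : ℕ) (hn : 0 < n) => T.exists_nhds_disjoint_iterate hX hn
  have hW : (⋂ n ∈ Ioo 0 N, V n) ∩ (closure (T.Xn N))ᶜ ∈ 𝓝 x :=
    inter_mem ((biInter_mem (finite_Ioo 0 N)).2 fun n hn => hV n hn.1)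
      (isClosed_closure.isOpen_compl.mem_nhds hN)
  obtain ⟨U, hUW, hU, hxU⟩ := mem_nhds_iff.1 hW
  obtain ⟨n, hn, _, ⟨y, ⟨hyU, hyI⟩, rfl⟩, hfU, -⟩ := hx U hU hxU
  by_cases hnN : n < N
  · have hmem : ∀ w ∈ U, w ∈ V n := fun w hw => mem_iInter₂.1 (hUW hw).1 n ⟨hn, hnN⟩
    exact hVd n hn y (hmem y hyU) hyI (hmem _ hfU)
  · exact (hUW hfU).2 (subset_closure (T.Xn_antitone (not_lt.1 hnN) ⟨y, hyI, rfl⟩))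

lemma exists_backward_orbit (T : ITM r) {x : ℝ} (hx : x ∈ T.X) :
    ∃ z : ℕ → ℝ, z 0 = x ∧ (∀ k, z k ∈ T.X) ∧ ∀ k, T.f (z (k + 1)) = z k := by
  choose! g hgX hgf using fun y (hy : y ∈ T.X) => T.exists_preimage_mem_X hy
  have hmem : ∀ k, g^[k] x ∈ T.X := by
    intro k
    induction k with
    | zero => exact hx
    | succ k ih => rw [Function.iterate_succ_apply']; exact hgX _ ih
  exact ⟨fun k => g^[k] x, rfl, hmem, fun k => by
    simp only [Function.iterate_succ_apply']; exact hgf _ (hmem k)⟩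

/-- Along a backward orbit `z` of `x` there are right neighbourhoods `[z k, z k + δ k)` carried
isometrically onto `[x, x + δ k)`, whose lengths only drop at discontinuities. -/
lemma exists_backward_intervals (T : ITM r) {x ε : ℝ} (hε : 0 < ε) (hx : x ∈ T.X) :
    ∃ (z δ : ℕ → ℝ) (i : ℕ → Fin r), (∀ k, z k ∈ unitIco) ∧ (∀ k, 0 < δ k) ∧ Antitone δ ∧
      (∀ k, δ k ≤ ε) ∧ (∀ k t, t ∈ Ico 0 (δ k) → T.f^[k] (z k + t) = x + t) ∧
      ∀ k, δ (k + 1) = δ k ∨ z (k + 1) + δ (k + 1) = T.beta (i k).succ := by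
  obtain ⟨z, hz0, hzX, hzf⟩ := T.exists_backward_orbit hx
  choose i hi using fun k => T.exists_mem_Ico (T.X_subset_unitIco (hzX (k + 1)))
  let δ : ℕ → ℝ := fun k => Nat.rec ε (fun k d => min d (T.beta (i k).succ - z (k + 1))) k
  have hδ : ∀ k, δ (k + 1) = min (δ k) (T.beta (i k).succ - z (k + 1)) := fun k => rfl
  have hanti : Antitone δ := antitone_nat_of_succ_le fun k => by rw [hδ]; exact min_le_left _ _
  refine ⟨z, δ, i, fun k => T.X_subset_unitIco (hzX k), fun k => ?_, hanti,
    fun k => hanti (Nat.zero_le k), fun k => ?_, fun k => ?_⟩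
  · induction k with
    | zero => exact hε
    | succ k ih => rw [hδ]; exact lt_min ih (sub_pos.2 (hi k).2)
  · induction k with
    | zero => intro t _; simp [hz0]
    | succ k ih =>
      intro t ht
      rw [hδ] at ht
      have h₁ := ht.2.trans_le (min_le_left _ _)
      have h₂ := ht.2.trans_le (min_le_right _ _)
      have hf : T.f (z (k + 1) + t) = z k + t := by
        rw [T.f_eq (i := i k) ⟨by linarith [(hi k).1, ht.1], by linarith⟩, ← hzf k, T.f_eq (hi k)]
        ring
      rw [Function.iterate_succ_apply, hf, ih t ⟨ht.1, h₁⟩]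
  · rw [hδ]
    rcases min_choice (δ k) (T.beta (i k).succ - z (k + 1)) with h | h
    · exact Or.inl h
    · exact Or.inr (by rw [h]; ring)

lemma exists_return (T : ITM r) {x ε : ℝ} (hε : 0 < ε) (hx : x ∈ T.X) :
    ∃ y ∈ Ico x (x + ε), ∃ n, 0 < n ∧ T.f^[n] y ∈ Ico x (x + ε) := by
  by_contra! hno
  obtain ⟨z, δ, i, hzI, hpos, hanti, hle, htrans, hdrop⟩ := T.exists_backward_intervals hε hx
  have hdisj : ∀ {k m s t}, k ≠ m → s ∈ Ico 0 (δ k) → t ∈ Ico 0 (δ m) → z k + s ≠ z m + t := by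
    have hlt : ∀ {k m s t}, k < m → s ∈ Ico 0 (δ k) → t ∈ Ico 0 (δ m) → z k + s ≠ z m + t := by
      intro k m s t hkm hs ht heq
      refine hno (x + s) ⟨by linarith [hs.1], by linarith [hs.2, hle k]⟩ (m - k)
        (Nat.sub_pos_of_lt hkm) ?_
      rw [← htrans k s hs, ← Function.iterate_add_apply, Nat.sub_add_cancel hkm.le, heq,
        htrans m t ht]
      exact ⟨by linarith [ht.1], by linarith [ht.2, hle m]⟩
    intro k m s t hkm hs ht
    rcases hkm.lt_or_gt with h | h
    · exact hlt h hs ht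
    · exact (hlt h ht hs).symm
  have hfin : {k | δ (k + 1) ≠ δ k}.Finite := by
    refine Set.Finite.of_finite_image (f := i) (toFinite _) fun k hk m hm hkm => ?_
    by_contra hne
    have h₁ := (hdrop k).resolve_left hk
    have h₂ := (hdrop m).resolve_left hm
    rw [← hkm] at h₂
    have hη : 0 < min (δ (k + 1)) (δ (m + 1)) := lt_min (hpos _) (hpos _)
    have hη₁ := min_le_left (δ (k + 1)) (δ (m + 1))
    have hη₂ := min_le_right (δ (k + 1)) (δ (m + 1))
    generalize min (δ (k + 1)) (δ (m + 1)) = η at hη hη₁ hη₂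
    exact hdisj (fun h => hne (Nat.succ_injective h))
      (s := δ (k + 1) - η / 2) (t := δ (m + 1) - η / 2)
      ⟨by linarith, by linarith⟩ ⟨by linarith, by linarith⟩ (by linarith)
  obtain ⟨K, hK⟩ := hfin.bddAbove
  have hconst : ∀ k, δ (K + 1 + k) = δ (K + 1) := by
    intro k
    induction k with
    | zero => rfl
    | succ k ih =>
      rw [← ih]
      by_contra hne
      have : K + 1 + k ≤ K := hK hne
      omega
  obtain ⟨a, -, φ, hφ, hlim⟩ := tendsto_subseq_of_bounded (Metric.isBounded_Ico 0 1)
    (fun k => hzI (K + 1 + k))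
  obtain ⟨N, hN⟩ := Metric.cauchySeq_iff'.1 hlim.cauchySeq (δ (K + 1)) (hpos _)
  have hclose := hN (N + 1) N.le_succ
  have hne : K + 1 + φ (N + 1) ≠ K + 1 + φ N := fun h =>
    (hφ N.lt_succ_self).ne' (Nat.add_left_cancel h)
  simp only [Function.comp_apply, Real.dist_eq, abs_lt] at hclose
  rcases le_total (z (K + 1 + φ (N + 1))) (z (K + 1 + φ N)) with h | h
  · exact hdisj hne (s := z (K + 1 + φ N) - z (K + 1 + φ (N + 1))) (t := 0)
      ⟨by linarith, by rw [hconst]; linarith⟩ ⟨le_rfl, hpos _⟩ (by ring)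
  · exact hdisj hne (s := 0) (t := z (K + 1 + φ (N + 1)) - z (K + 1 + φ N))
      ⟨le_rfl, hpos _⟩ ⟨by linarith, by rw [hconst]; linarith⟩ (by ring)

lemma closure_X_subset_Icc (T : ITM r) : closure T.X ⊆ Icc 0 1 :=
  closure_minimal (T.X_subset_unitIco.trans Ico_subset_Icc_self) isClosed_Icc

lemma closure_X_diff_subset_nonwandering (T : ITM r) : closure T.X \ {1} ⊆ T.nonwandering := by
  rintro x ⟨hx, hx1⟩
  have hxI := T.closure_X_subset_Icc hx
  refine ⟨⟨hxI.1, lt_of_le_of_ne hxI.2 hx1⟩, fun U hU hxU => ?_⟩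
  obtain ⟨w, hwU, hw⟩ := mem_closure_iff.1 hx U hU hxU
  have hwI := T.X_subset_unitIco hw
  obtain ⟨u, hu, hsub⟩ := exists_Ico_subset_of_mem_nhds
    (inter_mem (hU.mem_nhds hwU) (Iio_mem_nhds hwI.2)) (exists_gt w)
  have hmem : ∀ y ∈ Ico w (w + (u - w)), y ∈ U ∩ unitIco := fun y hy => by
    rw [add_sub_cancel] at hy
    exact ⟨(hsub hy).1, hwI.1.trans hy.1, (hsub hy).2⟩
  obtain ⟨y, hy, n, hn, hfy⟩ := T.exists_return (sub_pos.2 hu) hw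
  exact ⟨n, hn, _, mem_image_of_mem _ (hmem y hy), hmem _ hfy⟩

end ITM

/-- For every interval translation map `T ∈ ITM(r)`, the set `X̄ ∖ {1}` is equal to the
non-wandering set `Ω(T)`. -/
theorem xbar_diff_one_eq_nonwandering {r : ℕ} (T : ITM r) :
    T.Xbar \ {1} = T.nonwandering :=
  Subset.antisymm T.closure_X_diff_subset_nonwandering fun _ hx =>
    ⟨T.nonwandering_subset_closure hx, hx.1.2.ne⟩
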